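/- Let h(t) = (1-t)·(13/10 - √(t/(1-t))) for t ∈ [0,1/2], let g₂(y) = ((1-y)/y)·h(√(1-y)) for y ∈ [3/4, 1), and let q = 27/25. Then the function t ↦ (g₂(e^t))^q is concave on the interval [ln(3/4), ln(1 - 1/1089)]. -/

import Mathlib

/-- The parameter `√(s / (1 - s))` with `s = √(1 - exp t)`, in terms of which `g₂` is rational. -/
noncomputable def rootParam (t : ℝ) : ℝ :=
  Real.sqrt (Real.sqrt (1 - Real.exp t) / (1 - Real.sqrt (1 - Real.exp t)))

/-- The function `g₂` written in terms of the parameter `rootParam`. -/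
noncomputable def ratG (r : ℝ) : ℝ :=
  r ^ 4 * (13 / 10 - r) / ((1 + r ^ 2) * (1 + 2 * r ^ 2))

/-- The derivative of `ratG ∘ rootParam`, written in terms of the parameter. -/
noncomputable def ratP (r : ℝ) : ℝ :=
  -(26 / 5 - 5 * r + 39 / 5 * r ^ 2 - 9 * r ^ 3 - 2 * r ^ 5) /
    (4 * ((1 + r ^ 2) * (1 + 2 * r ^ 2)))

/-- The derivative of `ratP ∘ rootParam`, written in terms of the parameter. -/
noncomputable def ratP' (r : ℝ) : ℝ :=
  -((26 / 5 - 5 * r + 39 / 5 * r ^ 2 - 9 * r ^ 3 - 2 * r ^ 5) * (6 * r + 8 * r ^ 3) -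
      (-5 + 78 / 5 * r - 27 * r ^ 2 - 10 * r ^ 4) * ((1 + r ^ 2) * (1 + 2 * r ^ 2))) /
    (16 * r ^ 3 * ((1 + r ^ 2) * (1 + 2 * r ^ 2)))

lemma sqrt_one_sub_exp_pos {t : ℝ} (ht : t < 0) : 0 < Real.sqrt (1 - Real.exp t) :=
  Real.sqrt_pos.2 (by linarith [Real.exp_lt_one_iff.2 ht])

lemma sqrt_one_sub_exp_lt_one (t : ℝ) : Real.sqrt (1 - Real.exp t) < 1 := by
  rw [Real.sqrt_lt' one_pos]
  linarith [Real.exp_pos t]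

lemma rootParam_pos {t : ℝ} (ht : t < 0) : 0 < rootParam t :=
  Real.sqrt_pos.2 (div_pos (sqrt_one_sub_exp_pos ht) (by linarith [sqrt_one_sub_exp_lt_one t]))

lemma sqrt_one_sub_exp_eq (t : ℝ) :
    Real.sqrt (1 - Real.exp t) = rootParam t ^ 2 / (1 + rootParam t ^ 2) := by
  have h1 := sqrt_one_sub_exp_lt_one t
  have h2 : 1 - Real.sqrt (1 - Real.exp t) ≠ 0 := by linarith
  have h3 : rootParam t ^ 2 = Real.sqrt (1 - Real.exp t) / (1 - Real.sqrt (1 - Real.exp t)) :=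
    Real.sq_sqrt (div_nonneg (Real.sqrt_nonneg _) (by linarith))
  rw [h3]
  field_simp
  ring

lemma exp_eq_rootParam {t : ℝ} (ht : t < 0) :
    Real.exp t = (1 + 2 * rootParam t ^ 2) / (1 + rootParam t ^ 2) ^ 2 := by
  have h1 : Real.sqrt (1 - Real.exp t) ^ 2 = 1 - Real.exp t :=
    Real.sq_sqrt (by linarith [Real.exp_lt_one_iff.2 ht])
  rw [sqrt_one_sub_exp_eq] at h1
  have h2 : (1 + rootParam t ^ 2) ≠ 0 := by positivity
  rw [show Real.exp t = 1 - (rootParam t ^ 2 / (1 + rootParam t ^ 2)) ^ 2 by linarith]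
  field_simp
  ring

lemma hasDerivAt_rootParam {t : ℝ} (ht : t < 0) :
    HasDerivAt rootParam
      (-((1 + rootParam t ^ 2) * (1 + 2 * rootParam t ^ 2)) / (4 * rootParam t ^ 3)) t := by
  have hs0 := sqrt_one_sub_exp_pos ht
  have hs1 : 1 - Real.sqrt (1 - Real.exp t) ≠ 0 := by linarith [sqrt_one_sub_exp_lt_one t]
  have hr := rootParam_pos ht
  have hs := ((Real.hasDerivAt_exp t).const_sub 1).sqrt
    (by linarith [Real.exp_lt_one_iff.2 ht] : (0 : ℝ) < 1 - Real.exp t).ne'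
  have h := (hs.div (hs.const_sub 1) hs1).sqrt
    (div_pos hs0 (by linarith [sqrt_one_sub_exp_lt_one t])).ne'
  refine (h.congr_deriv ?_ : HasDerivAt rootParam _ t)
  change _ / (2 * rootParam t) = _
  rw [sqrt_one_sub_exp_eq, exp_eq_rootParam ht]
  have h2 : (1 + rootParam t ^ 2) ≠ 0 := by positivity
  have h3 : 1 - rootParam t ^ 2 / (1 + rootParam t ^ 2) = 1 / (1 + rootParam t ^ 2) := by
    field_simp
    ring
  rw [h3]
  field_simp
  ring

lemma hasDerivAt_ratG_rootParam {t : ℝ} (ht : t < 0) :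
    HasDerivAt (fun t => ratG (rootParam t)) (ratP (rootParam t)) t := by
  have hr := rootParam_pos ht
  have hρ := hasDerivAt_rootParam ht
  have hE : (1 + rootParam t ^ 2) * (1 + 2 * rootParam t ^ 2) ≠ 0 := by positivity
  have h := ((hρ.pow 4).mul (hρ.const_sub (13 / 10))).div
    (((hρ.pow 2).const_add 1).mul (((hρ.pow 2).const_mul 2).const_add 1)) hE
  refine (h.congr_deriv ?_ : HasDerivAt (fun t => ratG (rootParam t)) _ t)
  simp only [ratP, Pi.mul_apply, Pi.pow_apply]
  generalize rootParam t = r at *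
  field_simp
  ring

lemma hasDerivAt_ratP_rootParam {t : ℝ} (ht : t < 0) :
    HasDerivAt (fun t => ratP (rootParam t)) (ratP' (rootParam t)) t := by
  have hr := rootParam_pos ht
  have hρ := hasDerivAt_rootParam ht
  have hE : 4 * ((1 + rootParam t ^ 2) * (1 + 2 * rootParam t ^ 2)) ≠ 0 := by positivity
  have h := ((((((hρ.const_mul 5).const_sub (26 / 5)).add ((hρ.pow 2).const_mul (39 / 5))).sub
    ((hρ.pow 3).const_mul 9)).sub ((hρ.pow 5).const_mul 2)).neg).div
    ((((hρ.pow 2).const_add 1).mul (((hρ.pow 2).const_mul 2).const_add 1)).const_mul 4) hE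
  refine (h.congr_deriv ?_ : HasDerivAt (fun t => ratP (rootParam t)) _ t)
  simp only [ratP', Pi.mul_apply, Pi.pow_apply, Pi.neg_apply, Pi.sub_apply, Pi.add_apply]
  generalize rootParam t = r at *
  field_simp
  ring

lemma ratG_pos {r : ℝ} (h0 : 0 < r) (h1 : r ≤ 1) : 0 < ratG r :=
  div_pos (mul_pos (by positivity) (by linarith)) (by positivity)

lemma concavity_polynomial_nonneg {r : ℝ} (h0 : 353 / 2000 ≤ r) (h1 : r ≤ 1) :
    0 ≤ -5408 / 625 + 1066 / 25 * r + 16976 / 625 * r ^ 2 + 6864 / 125 * r ^ 3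
      + 75032 / 625 * r ^ 4 - 9802 / 125 * r ^ 5 + 2548 / 25 * r ^ 6 - 14352 / 125 * r ^ 7
      - 288 / 25 * r ^ 8 + 104 / 5 * r ^ 9 - 432 / 25 * r ^ 10 := by
  have hr : 0 ≤ r := by linarith
  have anti : ∀ {m n : ℕ}, m ≤ n → r ^ n ≤ r ^ m := fun h => pow_le_pow_of_le_one hr h1 h
  have h2 : (353 / 2000 : ℝ) ^ 2 ≤ r ^ 2 := by gcongr
  have h3 : (353 / 2000 : ℝ) ^ 3 ≤ r ^ 3 := by gcongr
  have h45 : r ^ 5 ≤ r ^ 4 := anti (by norm_num)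
  have h47 : r ^ 7 ≤ r ^ 4 := anti (by norm_num)
  have h67 : r ^ 7 ≤ r ^ 6 := anti (by norm_num)
  have h68 : r ^ 8 ≤ r ^ 6 := anti (by norm_num)
  have h610 : r ^ 10 ≤ r ^ 6 := anti (by norm_num)
  have h910 : r ^ 10 ≤ r ^ 9 := anti (by norm_num)
  have h10 : 0 ≤ r ^ 10 := by positivity
  norm_num at h2 h3
  linarith

lemma rat_second_deriv_nonpos {r : ℝ} (h0 : 353 / 2000 ≤ r) (h1 : r ≤ 1) :
    2 / 25 * ratP r ^ 2 + ratG r * ratP' r ≤ 0 := by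
  have hr : 0 < r := by linarith
  have key : 2 / 25 * ratP r ^ 2 + ratG r * ratP' r =
      -(-5408 / 625 + 1066 / 25 * r + 16976 / 625 * r ^ 2 + 6864 / 125 * r ^ 3
      + 75032 / 625 * r ^ 4 - 9802 / 125 * r ^ 5 + 2548 / 25 * r ^ 6 - 14352 / 125 * r ^ 7
      - 288 / 25 * r ^ 8 + 104 / 5 * r ^ 9 - 432 / 25 * r ^ 10) /
      (64 * ((1 + r ^ 2) * (1 + 2 * r ^ 2)) ^ 2) := by
    simp only [ratP, ratP', ratG]
    field_simp
    ring
  rw [key]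
  exact div_nonpos_of_nonpos_of_nonneg
    (neg_nonpos.2 (concavity_polynomial_nonneg h0 h1)) (by positivity)

lemma rootParam_mem {t : ℝ} (h1 : Real.log (3 / 4) ≤ t) (h2 : t ≤ Real.log (1 - 1 / 1089)) :
    353 / 2000 ≤ rootParam t ∧ rootParam t ≤ 1 := by
  have e1 : 3 / 4 ≤ Real.exp t := (Real.log_le_iff_le_exp (by norm_num)).1 h1
  have e2 : Real.exp t ≤ 1 - 1 / 1089 := (Real.le_log_iff_exp_le (by norm_num)).1 h2
  have s1 : 1 / 33 ≤ Real.sqrt (1 - Real.exp t) := Real.le_sqrt_of_sq_le (by norm_num; linarith)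
  have s2 : Real.sqrt (1 - Real.exp t) ≤ 1 / 2 :=
    Real.sqrt_le_iff.2 ⟨by norm_num, by norm_num; linarith⟩
  constructor
  · refine Real.le_sqrt_of_sq_le ?_
    rw [le_div_iff₀ (by linarith)]
    linarith
  · refine Real.sqrt_le_one.2 ?_
    rw [div_le_one (by linarith)]
    linarith

lemma g₂_exp_eq_ratG {t : ℝ} (ht : t < 0) :
    (1 - Real.exp t) / Real.exp t * ((1 - Real.sqrt (1 - Real.exp t)) *
      (13 / 10 - Real.sqrt (Real.sqrt (1 - Real.exp t) / (1 - Real.sqrt (1 - Real.exp t))))) =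
      ratG (rootParam t) := by
  change _ * (_ * (_ - rootParam t)) = _
  rw [sqrt_one_sub_exp_eq, exp_eq_rootParam ht, ratG]
  generalize rootParam t = r
  field_simp
  ring

theorem stmt_13 (h : ℝ → ℝ)
    (hh : ∀ u : ℝ, h u = (1 - u) * (13 / 10 - Real.sqrt (u / (1 - u))))
    (g₂ : ℝ → ℝ) (hg : ∀ y : ℝ, g₂ y = ((1 - y) / y) * h (Real.sqrt (1 - y))) :
    ConcaveOn ℝ (Set.Icc (Real.log (3 / 4)) (Real.log (1 - 1 / 1089)))
      (fun t : ℝ => (g₂ (Real.exp t)) ^ ((27 : ℝ) / 25)) := by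
  have hneg : ∀ t ∈ Set.Icc (Real.log (3 / 4)) (Real.log (1 - 1 / 1089)), t < 0 := fun t ht =>
    ht.2.trans_lt (Real.log_neg (by norm_num) (by norm_num))
  have hpos : ∀ t ∈ Set.Icc (Real.log (3 / 4)) (Real.log (1 - 1 / 1089)),
      0 < ratG (rootParam t) := fun t ht =>
    ratG_pos (rootParam_pos (hneg t ht)) (rootParam_mem ht.1 ht.2).2
  have hF : ∀ t ∈ Set.Icc (Real.log (3 / 4)) (Real.log (1 - 1 / 1089)),
      HasDerivAt (fun t => ratG (rootParam t) ^ ((27 : ℝ) / 25))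
        (ratP (rootParam t) * (27 / 25) * ratG (rootParam t) ^ ((27 : ℝ) / 25 - 1)) t :=
    fun t ht => (hasDerivAt_ratG_rootParam (hneg t ht)).rpow_const (Or.inl (hpos t ht).ne')
  have main : ConcaveOn ℝ (Set.Icc (Real.log (3 / 4)) (Real.log (1 - 1 / 1089)))
      (fun t => ratG (rootParam t) ^ ((27 : ℝ) / 25)) := by
    refine concaveOn_of_hasDerivWithinAt2_nonpos (convex_Icc _ _)
      (fun t ht => (hF t ht).continuousAt.continuousWithinAt)
      (fun t ht => (hF t (interior_subset ht)).hasDerivWithinAt)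
      (fun t ht => (((hasDerivAt_ratP_rootParam (hneg t (interior_subset ht))).mul_const
        (27 / 25)).mul ((hasDerivAt_ratG_rootParam (hneg t (interior_subset ht))).rpow_const
          (Or.inl (hpos t (interior_subset ht)).ne'))).hasDerivWithinAt) ?_
    intro t ht
    have ht := interior_subset ht
    obtain ⟨m1, m2⟩ := rootParam_mem ht.1 ht.2
    have hG := hpos t ht
    have hsplit : ratG (rootParam t) ^ ((27 : ℝ) / 25 - 1) =
        ratG (rootParam t) ^ ((27 : ℝ) / 25 - 1 - 1) * ratG (rootParam t) := by
      rw [← Real.rpow_add_one hG.ne']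
      norm_num
    rw [hsplit]
    have := mul_nonpos_of_nonneg_of_nonpos
      (Real.rpow_nonneg hG.le ((27 : ℝ) / 25 - 1 - 1)) (rat_second_deriv_nonpos m1 m2)
    linarith
  refine main.congr fun t ht => ?_
  simp only [hg, hh]
  rw [g₂_exp_eq_ratG (hneg t ht)]
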